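/- Let n be a natural number and let b : ℕ → ℕ be a sequence (the even Betti numbers b_i = b_{2i} of a smooth projective variety of dimension n) satisfying the Poincaré duality symmetry b_{n-i} = b_i for all 0 ≤ i ≤ n. Set χ = ∑_{i=0}^n b_i and define the F₁-zeta function ζ : ℂ → ℂ by ζ(s) = ∏_{i=0}^n (s - i)^{-b_i}. Then for every s ∈ ℂ such that s ≠ i for all integers 0 ≤ i ≤ n, the functional equation ζ(n - s) = (-1)^χ · ζ(s) holds. -/

import Mathlib

/-- Functional equation for the F₁-zeta function of a smooth projective
F₁-scheme: if the (even) Betti numbers `b i` (for `0 ≤ i ≤ n`) satisfy the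
Poincaré duality symmetry `b (n - i) = b i`, `χ = ∑_{i=0}^n b i`, and
`ζ s = ∏_{i=0}^n (s - i) ^ (-(b i))`, then `ζ (n - s) = (-1)^χ * ζ s`
for all `s` avoiding the integers `0, …, n`. -/
theorem f1_zeta_functional_equation_smooth_projective
    (n : ℕ) (b : ℕ → ℕ) (hsym : ∀ i ≤ n, b (n - i) = b i)
    (χ : ℕ) (hχ : χ = ∑ i ∈ Finset.range (n + 1), b i)
    (ζ : ℂ → ℂ)
    (hζ : ∀ s : ℂ, ζ s = ∏ i ∈ Finset.range (n + 1), (s - (i : ℂ)) ^ (-(b i : ℤ)))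
    (s : ℂ) (hs : ∀ i : ℕ, i ≤ n → s ≠ (i : ℂ)) :
    ζ ((n : ℂ) - s) = (-1) ^ χ * ζ s := by
  rw [hζ, hζ, hχ, ← Finset.prod_pow_eq_pow_sum, ← Finset.prod_mul_distrib,
    ← Finset.prod_range_reflect]
  refine Finset.prod_congr rfl fun i hi => ?_
  have hi : i ≤ n := Nat.lt_succ_iff.mp (Finset.mem_range.mp hi)
  rw [Nat.add_sub_cancel, hsym i hi, Nat.cast_sub hi,
    show (n : ℂ) - s - (n - i) = -1 * (s - i) by ring, mul_zpow, zpow_neg, zpow_natCast,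
    ← inv_pow, inv_neg_one]
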